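/- arXiv:2308.02411 — 2 statements merged into one kernel-verified Lean document; each statement's English description precedes it below -/
import Mathlib

section
/- Let (L,π_1,π_2,α) be a compatible Hom-Leibniz algebra, d_1 := [π_1,·]_B, d_2 := [π_2,·]_B, and let π̃_1, π̃_2 ∈ C_α^2(L,L). Then (L, π_1 + π̃_1, π_2 + π̃_2, α) is a compatible Hom-Leibniz algebra if and only if (π̃_1,π̃_2) is a Maurer–Cartan element of the bi-differential graded Lie algebra (C_α^*(L,L), [·,·]_B, d_1, d_2), i.e. if and only if d_1(π̃_1) + (1/2)[π̃_1,π̃_1]_B = 0, d_2(π̃_2) + (1/2)[π̃_2,π̃_2]_B = 0, and d_2(π̃_1) + d_1(π̃_2) + [π̃_1,π̃_2]_B = 0. -/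
open Finset

variable {K : Type*} [Field K] [CharZero K]
variable {L : Type*} [AddCommGroup L] [Module K L]
variable {M : Type*} [AddCommGroup M] [Module K M]

/-- `σ` is an `(i, m-i)`-shuffle. -/
def IsShuffle {m : ℕ} (i : ℕ) (σ : Equiv.Perm (Fin m)) : Prop :=
  (∀ a b : Fin m, a < b → (b : ℕ) < i → σ a < σ b) ∧
  (∀ a b : Fin m, a < b → i ≤ (a : ℕ) → σ a < σ b)

instance {m : ℕ} (i : ℕ) (σ : Equiv.Perm (Fin m)) : Decidable (IsShuffle i σ) := by
  unfold IsShuffle; infer_instance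

/-- The circle product `P ∘ Q = Σ_{k=1}^{p+1} (−1)^{(k−1)q} P∘_k Q` of Balavoine, where
`(P∘_k Q)(x_1,…,x_{p+q+1}) = Σ_{σ ∈ S(k−1,q)} (−1)^σ P(α^p x_{σ(1)},…,α^p x_{σ(k−1)},
Q(x_{σ(k)},…,x_{σ(k+q−1)},x_{k+q}), α^p x_{k+q+1},…,α^p x_{p+q+1})`. -/
noncomputable def hcomp (α : L → L) (p q : ℕ)
    (P : (Fin (p + 1) → L) → L) (Q : (Fin (q + 1) → L) → L) :
    (Fin (p + q + 1) → L) → L :=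
  fun x => ∑ j : Fin (p + 1), (-1 : ℤ) ^ ((j : ℕ) * q) •
    ∑ σ ∈ Finset.univ.filter (fun σ : Equiv.Perm (Fin ((j : ℕ) + q)) => IsShuffle (j : ℕ) σ),
      ((Equiv.Perm.sign σ : ℤ)) •
        P (fun i : Fin (p + 1) =>
          if h : (i : ℕ) < (j : ℕ) then
            α^[p] (x (Fin.castLE (by have := j.isLt; omega)
              (σ ⟨(i : ℕ), by have := j.isLt; omega⟩)))
          else if (i : ℕ) = (j : ℕ) then
            Q (fun a : Fin (q + 1) =>
              if ha : (a : ℕ) < q then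
                x (Fin.castLE (by have := j.isLt; omega)
                  (σ ⟨(j : ℕ) + (a : ℕ), by omega⟩))
              else x ⟨(j : ℕ) + q, by have := j.isLt; omega⟩)
          else α^[p] (x ⟨(i : ℕ) + q, by have := i.isLt; omega⟩))

/-- Reindexing a cochain along an equality of arities. -/
def recast {m n : ℕ} (h : m = n) (f : (Fin m → L) → L) : (Fin n → L) → L :=
  fun x => f (fun i => x (Fin.cast h i))

/-- The Balavoine bracket `[P,Q]_B = P∘Q − (−1)^{pq} Q∘P` for `P` of degree `p`
(arity `p+1`) and `Q` of degree `q` (arity `q+1`). -/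
noncomputable def balavoine (α : L → L) (p q : ℕ)
    (P : (Fin (p + 1) → L) → L) (Q : (Fin (q + 1) → L) → L) :
    (Fin (p + q + 1) → L) → L :=
  hcomp α p q P Q - ((-1 : ℤ) ^ (p * q)) • recast (by omega) (hcomp α q p Q P)

/-- View a bilinear operation as a 2-cochain. -/
def c2 {L : Type*} (b : L → L → L) : (Fin 2 → L) → L := fun x => b (x 0) (x 1)

/-- A bilinear map, phrased for plain curried functions. -/
def IsBilinMap (K : Type*) [Field K] {L M N : Type*} [AddCommGroup L] [Module K L]
    [AddCommGroup M] [Module K M] [AddCommGroup N] [Module K N] (b : L → M → N) : Prop :=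
  (∀ x, IsLinearMap K (b x)) ∧ (∀ y, IsLinearMap K (fun x => b x y))

/-- A multiplicative Hom-Leibniz algebra structure `(L, b, α)`:
`α` linear, `b` bilinear, `α` multiplicative for `b`, and the Hom-Leibniz identity. -/
def IsHomLeibniz (K : Type*) [Field K] {L : Type*} [AddCommGroup L] [Module K L]
    (α : L → L) (b : L → L → L) : Prop :=
  IsLinearMap K α ∧ IsBilinMap K b ∧
  (∀ x y, α (b x y) = b (α x) (α y)) ∧
  (∀ x y z, b (α x) (b y z) = b (b x y) (α z) + b (α y) (b x z))

/-- A compatible Hom-Leibniz algebra structure `(L, b₁, b₂, α)`. -/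
def IsCompatibleHomLeibniz (K : Type*) [Field K] {L : Type*} [AddCommGroup L] [Module K L]
    (α : L → L) (b₁ b₂ : L → L → L) : Prop :=
  IsHomLeibniz K α b₁ ∧ IsHomLeibniz K α b₂ ∧
  (∀ x y z, b₁ (α x) (b₂ y z) + b₂ (α x) (b₁ y z) =
    b₁ (b₂ x y) (α z) + b₂ (b₁ x y) (α z) + b₁ (α y) (b₂ x z) + b₂ (α y) (b₁ x z))

lemma hcomp_one_one (α : L → L) (b c : L → L → L) (x : Fin 3 → L) :
    hcomp α 1 1 (c2 b) (c2 c) x =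
      b (c (x 0) (x 1)) (α (x 2)) - b (α (x 0)) (c (x 1) (x 2))
        + b (α (x 1)) (c (x 0) (x 2)) := by
  have shuffles_zero : (Finset.univ.filter
      (fun σ : Equiv.Perm (Fin (((0 : Fin 2) : ℕ) + 1)) => IsShuffle ((0 : Fin 2) : ℕ) σ)) =
      {(1 : Equiv.Perm (Fin 1))} := by decide
  have shuffles_one : (Finset.univ.filter
      (fun σ : Equiv.Perm (Fin (((1 : Fin 2) : ℕ) + 1)) => IsShuffle ((1 : Fin 2) : ℕ) σ)) =
      {(1 : Equiv.Perm (Fin 2)), Equiv.swap 0 1} := by decide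
  have sum_shuffles_one (f : Equiv.Perm (Fin (((1 : Fin 2) : ℕ) + 1)) → L) :
      ∑ σ ∈ Finset.univ.filter (fun σ => IsShuffle ((1 : Fin 2) : ℕ) σ), f σ =
        f (1 : Equiv.Perm (Fin 2)) + f (Equiv.swap (0 : Fin 2) 1) := by
    rw [shuffles_one]
    exact Finset.sum_pair (by decide)
  have sign_swap : Equiv.Perm.sign (Equiv.swap (0 : Fin 2) 1) = -1 := by decide
  unfold hcomp
  rw [Fin.sum_univ_two, shuffles_zero, sum_shuffles_one, Finset.sum_singleton, sign_swap]
  have h : ∀ u v w : L, u = b (c (x 0) (x 1)) (α (x 2)) → v = b (α (x 0)) (c (x 1) (x 2)) →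
      w = b (α (x 1)) (c (x 0) (x 2)) →
      (-1 : ℤ) ^ (0 * 1) • ((Equiv.Perm.sign (1 : Equiv.Perm (Fin 1)) : ℤ)) • u +
        (-1 : ℤ) ^ (1 * 1) • (((Equiv.Perm.sign (1 : Equiv.Perm (Fin 2)) : ℤ)) • v +
          ((-1 : ℤˣ) : ℤ) • w) =
      b (c (x 0) (x 1)) (α (x 2)) - b (α (x 0)) (c (x 1) (x 2))
        + b (α (x 1)) (c (x 0) (x 2)) := by
    rintro u v w rfl rfl rfl
    simp
    abel
  exact h _ _ _ rfl rfl rfl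

lemma balavoine_one_one (α : L → L) (b c : L → L → L) (x : Fin 3 → L) :
    balavoine α 1 1 (c2 b) (c2 c) x =
      (b (c (x 0) (x 1)) (α (x 2)) - b (α (x 0)) (c (x 1) (x 2))
        + b (α (x 1)) (c (x 0) (x 2))) +
      (c (b (x 0) (x 1)) (α (x 2)) - c (α (x 0)) (b (x 1) (x 2))
        + c (α (x 1)) (b (x 0) (x 2))) := by
  rw [← hcomp_one_one, ← hcomp_one_one]
  simp [balavoine, recast]

lemma IsBilinMap.add {K L : Type*} [Field K] [AddCommGroup L] [Module K L] {b c : L → L → L}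
    (hb : IsBilinMap K b) (hc : IsBilinMap K c) :
    IsBilinMap K (fun x y => b x y + c x y) :=
  ⟨fun x => (IsLinearMap.mk' _ (hb.1 x) + IsLinearMap.mk' _ (hc.1 x)).isLinear,
    fun y => (IsLinearMap.mk' _ (hb.2 y) + IsLinearMap.mk' _ (hc.2 y)).isLinear⟩

lemma isHomLeibniz_add_iff {α : L → L} {b t : L → L → L} (hb : IsHomLeibniz K α b)
    (ht : IsBilinMap K t) (hc : ∀ x y, α (t x y) = t (α x) (α y)) :
    IsHomLeibniz K α (fun x y => b x y + t x y) ↔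
      balavoine α 1 1 (c2 b) (c2 t) + (2⁻¹ : K) • balavoine α 1 1 (c2 t) (c2 t) = 0 := by
  obtain ⟨hα, hbb, hbα, hbL⟩ := hb
  have half (v : L) : (2⁻¹ : K) • (v + v) = v := by
    rw [← two_smul K v, inv_smul_smul₀ two_ne_zero]
  have key (x y z : L) : (b (α x) (b y z + t y z) + t (α x) (b y z + t y z) =
      b (b x y + t x y) (α z) + t (b x y + t x y) (α z) +
        (b (α y) (b x z + t x z) + t (α y) (b x z + t x z))) ↔
      (balavoine α 1 1 (c2 b) (c2 t) + (2⁻¹ : K) • balavoine α 1 1 (c2 t) (c2 t)) ![x, y, z] =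
        0 := by
    rw [Pi.add_apply, Pi.smul_apply, balavoine_one_one, balavoine_one_one, half]
    simp only [(hbb.1 _).map_add, (ht.1 _).map_add, (hbb.2 _).map_add, (ht.2 _).map_add,
      Matrix.cons_val]
    rw [← sub_eq_zero, ← neg_eq_zero]
    refine Eq.congr ?_ rfl
    have h₀ := neg_eq_zero.2 (sub_eq_zero.2 (hbL x y z))
    rw [← sub_eq_zero, ← h₀]
    abel
  constructor
  · rintro ⟨-, -, -, h⟩
    funext x
    rw [show x = ![x 0, x 1, x 2] from by ext i; fin_cases i <;> rfl]
    exact (key _ _ _).1 (h _ _ _)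
  · intro h
    refine ⟨hα, hbb.add ht, fun x y => ?_, fun x y z => (key x y z).2 (congrFun h _)⟩
    rw [hα.map_add, hbα, hc]

/-- For a compatible Hom-Leibniz algebra `(L,π₁,π₂,α)` and
`π̃₁, π̃₂ ∈ C_α^2(L,L)`, `(L, π₁+π̃₁, π₂+π̃₂, α)` is a compatible Hom-Leibniz
algebra iff `(π̃₁,π̃₂)` is a Maurer–Cartan element of the b-dgLa
`(C_α^*(L,L), [·,·]_B, d₁, d₂)`, i.e. iff `d₁π̃₁ + ½[π̃₁,π̃₁]_B = 0`,
`d₂π̃₂ + ½[π̃₂,π̃₂]_B = 0` and `d₂π̃₁ + d₁π̃₂ + [π̃₁,π̃₂]_B = 0`. -/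
theorem deformed_compatible_iff_maurerCartan
    (α : L → L) (π₁ π₂ : L → L → L) (h : IsCompatibleHomLeibniz K α π₁ π₂)
    (t₁ t₂ : L → L → L) (ht₁ : IsBilinMap K t₁) (ht₂ : IsBilinMap K t₂)
    (hc₁ : ∀ x y, α (t₁ x y) = t₁ (α x) (α y))
    (hc₂ : ∀ x y, α (t₂ x y) = t₂ (α x) (α y)) :
    IsCompatibleHomLeibniz K α (fun x y => π₁ x y + t₁ x y)
        (fun x y => π₂ x y + t₂ x y) ↔
      (balavoine α 1 1 (c2 π₁) (c2 t₁)
          + (2⁻¹ : K) • balavoine α 1 1 (c2 t₁) (c2 t₁) = 0 ∧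
       balavoine α 1 1 (c2 π₂) (c2 t₂)
          + (2⁻¹ : K) • balavoine α 1 1 (c2 t₂) (c2 t₂) = 0 ∧
       balavoine α 1 1 (c2 π₂) (c2 t₁) + balavoine α 1 1 (c2 π₁) (c2 t₂)
          + balavoine α 1 1 (c2 t₁) (c2 t₂) = 0) := by
  obtain ⟨h₁, h₂, h₁₂⟩ := h
  have key (x y z : L) : (π₁ (α x) (π₂ y z + t₂ y z) + t₁ (α x) (π₂ y z + t₂ y z) +
        (π₂ (α x) (π₁ y z + t₁ y z) + t₂ (α x) (π₁ y z + t₁ y z)) =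
      π₁ (π₂ x y + t₂ x y) (α z) + t₁ (π₂ x y + t₂ x y) (α z) +
        (π₂ (π₁ x y + t₁ x y) (α z) + t₂ (π₁ x y + t₁ x y) (α z)) +
        (π₁ (α y) (π₂ x z + t₂ x z) + t₁ (α y) (π₂ x z + t₂ x z)) +
        (π₂ (α y) (π₁ x z + t₁ x z) + t₂ (α y) (π₁ x z + t₁ x z))) ↔
      (balavoine α 1 1 (c2 π₂) (c2 t₁) + balavoine α 1 1 (c2 π₁) (c2 t₂)
          + balavoine α 1 1 (c2 t₁) (c2 t₂)) ![x, y, z] = 0 := by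
    simp only [Pi.add_apply, balavoine_one_one, (h₁.2.1.1 _).map_add, (h₁.2.1.2 _).map_add,
      (h₂.2.1.1 _).map_add, (h₂.2.1.2 _).map_add, (ht₁.1 _).map_add, (ht₁.2 _).map_add,
      (ht₂.1 _).map_add, (ht₂.2 _).map_add, Matrix.cons_val]
    rw [← sub_eq_zero, ← neg_eq_zero]
    refine Eq.congr ?_ rfl
    have h₀ := neg_eq_zero.2 (sub_eq_zero.2 (h₁₂ x y z))
    rw [← sub_eq_zero, ← h₀]
    abel
  unfold IsCompatibleHomLeibniz
  rw [isHomLeibniz_add_iff h₁ ht₁ hc₁, isHomLeibniz_add_iff h₂ ht₂ hc₂]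
  refine and_congr_right fun _ => and_congr_right fun _ => ⟨fun h => ?_, fun h x y z => ?_⟩
  · funext x
    rw [show x = ![x 0, x 1, x 2] from by ext i; fin_cases i <;> rfl]
    exact (key _ _ _).1 (h _ _ _)
  · exact (key x y z).2 (congrFun h _)
end

section
/- Let (L,μ_0,m_0,α) be a compatible Hom-Leibniz algebra and μ_1, m_1 ∈ C_α^2(L,L). Then (μ_1,m_1) generates an infinitesimal deformation (i.e. (L, μ_0 + tμ_1, m_0 + tm_1, α) is a compatible Hom-Leibniz algebra for every t ∈ K) if and only if [μ_0,μ_1]_B = 0, [m_0,m_1]_B = 0, [μ_0,m_1]_B + [μ_1,m_0]_B = 0, [μ_1,μ_1]_B = 0, [m_1,m_1]_B = 0 and [μ_1,m_1]_B = 0. In particular, if (μ_1,m_1) generates an infinitesimal deformation then d^2(μ_1,m_1) = 0 (i.e. (μ_1,m_1) is a 2-cocycle of the compatible Hom-Leibniz cohomology) and (L,μ_1,m_1,α) is itself a compatible Hom-Leibniz algebra. -/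
open Finset

variable {K : Type*} [Field K] [CharZero K]
variable {L : Type*} [AddCommGroup L] [Module K L]
variable {M : Type*} [AddCommGroup M] [Module K M]

theorem hcomp_c2 {L : Type*} [AddCommGroup L] (α : L → L) (a b : L → L → L) (x : Fin 3 → L) :
    hcomp α 1 1 (c2 a) (c2 b) x =
      a (b (x 0) (x 1)) (α (x 2)) - a (α (x 0)) (b (x 1) (x 2)) +
        a (α (x 1)) (b (x 0) (x 2)) := by
  have shuffles_one : (Finset.univ.filter
      (fun σ : Equiv.Perm (Fin (0 + 1)) => IsShuffle 0 σ)) = {1} := by decide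
  have shuffles_two : (Finset.univ.filter
      (fun σ : Equiv.Perm (Fin (1 + 1)) => IsShuffle 1 σ)) = {1, Equiv.swap 0 1} := by decide
  have one_ne_swap : (1 : Equiv.Perm (Fin (1 + 1))) ≠ Equiv.swap 0 1 := by decide
  unfold hcomp
  rw [Fin.sum_univ_two]
  simp only [Fin.val_zero, Fin.val_one]
  rw [shuffles_one, shuffles_two, Finset.sum_singleton, Finset.sum_pair one_ne_swap]
  simp [c2]
  abel

theorem balavoine_c2 {L : Type*} [AddCommGroup L] (α : L → L) (a b : L → L → L)
    (x : Fin 3 → L) :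
    balavoine α 1 1 (c2 a) (c2 b) x =
      (a (b (x 0) (x 1)) (α (x 2)) - a (α (x 0)) (b (x 1) (x 2)) +
        a (α (x 1)) (b (x 0) (x 2))) +
      (b (a (x 0) (x 1)) (α (x 2)) - b (α (x 0)) (a (x 1) (x 2)) +
        b (α (x 1)) (a (x 0) (x 2))) := by
  have hrecast : recast rfl (hcomp α 1 1 (c2 b) (c2 a)) x = hcomp α 1 1 (c2 b) (c2 a) x := rfl
  simp [balavoine, hcomp_c2, hrecast]
  abel

theorem balavoine_c2_comm {L : Type*} [AddCommGroup L] (α : L → L) (a b : L → L → L) :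
    balavoine α 1 1 (c2 a) (c2 b) = balavoine α 1 1 (c2 b) (c2 a) := by
  funext x
  rw [balavoine_c2, balavoine_c2, add_comm]

theorem balavoine_c2_eq_zero_iff {L : Type*} [AddCommGroup L] (α : L → L) (a b : L → L → L) :
    balavoine α 1 1 (c2 a) (c2 b) = 0 ↔
      ∀ x y z, a (α x) (b y z) + b (α x) (a y z) =
        a (b x y) (α z) + b (a x y) (α z) + a (α y) (b x z) + b (α y) (a x z) := by
  constructor
  · intro h x y z
    have hxyz := congrFun h ![x, y, z]
    rw [balavoine_c2] at hxyz
    simp only [Matrix.cons_val, Pi.zero_apply] at hxyz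
    rw [← sub_eq_zero, ← neg_eq_zero, ← hxyz]
    abel
  · intro h
    funext x
    rw [balavoine_c2, Pi.zero_apply, ← neg_eq_zero,
      ← sub_eq_zero.mpr (h (x 0) (x 1) (x 2))]
    abel

theorem balavoine_c2_self_eq_zero_iff (K : Type*) [Field K] [CharZero K] {L : Type*}
    [AddCommGroup L] [Module K L] (α : L → L) (b : L → L → L) :
    balavoine α 1 1 (c2 b) (c2 b) = 0 ↔
      ∀ x y z, b (α x) (b y z) = b (b x y) (α z) + b (α y) (b x z) := by
  rw [balavoine_c2_eq_zero_iff]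
  refine forall₃_congr fun x y z => ⟨fun h => ?_, fun h => ?_⟩
  · refine smul_right_injective L (two_ne_zero (α := K)) ?_
    simp only [two_smul]
    rw [h]
    abel
  · rw [h]
    abel

theorem isCompatibleHomLeibniz_iff_balavoine {K : Type*} [Field K] [CharZero K] {L : Type*}
    [AddCommGroup L] [Module K L] {α : L → L} {b c : L → L → L} (hα : IsLinearMap K α)
    (hb : IsBilinMap K b) (hc : IsBilinMap K c) (hαb : ∀ x y, α (b x y) = b (α x) (α y))
    (hαc : ∀ x y, α (c x y) = c (α x) (α y)) :
    IsCompatibleHomLeibniz K α b c ↔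
      balavoine α 1 1 (c2 b) (c2 b) = 0 ∧ balavoine α 1 1 (c2 c) (c2 c) = 0 ∧
        balavoine α 1 1 (c2 b) (c2 c) = 0 := by
  rw [balavoine_c2_self_eq_zero_iff K, balavoine_c2_self_eq_zero_iff K, balavoine_c2_eq_zero_iff]
  simp only [IsCompatibleHomLeibniz, IsHomLeibniz]
  tauto

theorem IsBilinMap.add_smul {K : Type*} [Field K] {L : Type*} [AddCommGroup L] [Module K L]
    {a b : L → L → L} (ha : IsBilinMap K a) (hb : IsBilinMap K b) (t : K) :
    IsBilinMap K (fun x y => a x y + t • b x y) := by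
  refine ⟨fun x => ⟨fun y z => ?_, fun c y => ?_⟩, fun y => ⟨fun x z => ?_, fun c x => ?_⟩⟩
  all_goals beta_reduce
  · rw [(ha.1 x).map_add, (hb.1 x).map_add]
    module
  · rw [(ha.1 x).map_smul, (hb.1 x).map_smul]
    module
  · rw [(ha.2 y).map_add, (hb.2 y).map_add]
    module
  · rw [(ha.2 y).map_smul, (hb.2 y).map_smul]
    module

theorem balavoine_c2_add_smul {K : Type*} [Field K] {L : Type*} [AddCommGroup L] [Module K L]
    (α : L → L) {a a' b b' : L → L → L} (ha : IsBilinMap K a) (ha' : IsBilinMap K a')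
    (hb : IsBilinMap K b) (hb' : IsBilinMap K b') (t : K) :
    balavoine α 1 1 (c2 fun x y => a x y + t • a' x y) (c2 fun x y => b x y + t • b' x y) =
      balavoine α 1 1 (c2 a) (c2 b) +
        t • (balavoine α 1 1 (c2 a) (c2 b') + balavoine α 1 1 (c2 a') (c2 b)) +
        t ^ 2 • balavoine α 1 1 (c2 a') (c2 b') := by
  have left_add {c : L → L → L} (hc : IsBilinMap K c) (x y z : L) :
      c (x + t • y) z = c x z + t • c y z := by
    rw [(hc.2 z).map_add, (hc.2 z).map_smul]
  have right_add {c : L → L → L} (hc : IsBilinMap K c) (x y z : L) :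
      c z (x + t • y) = c z x + t • c z y := by
    rw [(hc.1 z).map_add, (hc.1 z).map_smul]
  funext x
  simp only [Pi.add_apply, Pi.smul_apply, balavoine_c2, left_add ha, left_add ha', left_add hb,
    left_add hb', right_add ha, right_add ha', right_add hb, right_add hb']
  module

theorem forall_smul_add_sq_smul_eq_zero_iff (K : Type*) [Field K] [CharZero K] {V : Type*}
    [AddCommGroup V] [Module K V] (u v : V) :
    (∀ t : K, t • u + t ^ 2 • v = 0) ↔ u = 0 ∧ v = 0 := by
  refine ⟨fun h => ?_, fun ⟨hu, hv⟩ t => by simp [hu, hv]⟩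
  have hone := h 1
  have hneg := h (-1)
  have hv : (2 : K) • v = 0 := by
    linear_combination (norm := module) hone + hneg
  have hv := (smul_eq_zero_iff_right two_ne_zero).mp hv
  exact ⟨by simpa [hv] using hone, hv⟩

/-- `(μ₁,m₁)` generates an infinitesimal deformation of the
compatible Hom-Leibniz algebra `(L,μ₀,m₀,α)` iff the six Balavoine-bracket
conditions hold; in particular, in that case `(μ₁,m₁)` is a 2-cocycle and
`(L,μ₁,m₁,α)` is itself a compatible Hom-Leibniz algebra. -/
theorem infinitesimal_deformation_iff
    (α : L → L) (μ₀ m₀ : L → L → L) (h : IsCompatibleHomLeibniz K α μ₀ m₀)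
    (μ₁ m₁ : L → L → L) (hμ : IsBilinMap K μ₁) (hm : IsBilinMap K m₁)
    (hcμ : ∀ x y, α (μ₁ x y) = μ₁ (α x) (α y))
    (hcm : ∀ x y, α (m₁ x y) = m₁ (α x) (α y)) :
    ((∀ t : K, IsCompatibleHomLeibniz K α (fun x y => μ₀ x y + t • μ₁ x y)
        (fun x y => m₀ x y + t • m₁ x y)) ↔
      (balavoine α 1 1 (c2 μ₀) (c2 μ₁) = 0 ∧
       balavoine α 1 1 (c2 m₀) (c2 m₁) = 0 ∧
       balavoine α 1 1 (c2 μ₀) (c2 m₁) + balavoine α 1 1 (c2 μ₁) (c2 m₀) = 0 ∧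
       balavoine α 1 1 (c2 μ₁) (c2 μ₁) = 0 ∧
       balavoine α 1 1 (c2 m₁) (c2 m₁) = 0 ∧
       balavoine α 1 1 (c2 μ₁) (c2 m₁) = 0)) ∧
    ((∀ t : K, IsCompatibleHomLeibniz K α (fun x y => μ₀ x y + t • μ₁ x y)
        (fun x y => m₀ x y + t • m₁ x y)) →
      ((balavoine α 1 1 (c2 μ₀) (c2 μ₁) = 0 ∧
        balavoine α 1 1 (c2 m₀) (c2 μ₁) + balavoine α 1 1 (c2 μ₀) (c2 m₁) = 0 ∧
        balavoine α 1 1 (c2 m₀) (c2 m₁) = 0) ∧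
       IsCompatibleHomLeibniz K α μ₁ m₁)) := by
  obtain ⟨⟨hα, hμ₀, hcμ₀, -⟩, ⟨-, hm₀, hcm₀, -⟩, -⟩ := id h
  have mult {a b : L → L → L} (ha : ∀ x y, α (a x y) = a (α x) (α y))
      (hb : ∀ x y, α (b x y) = b (α x) (α y)) (t : K) (x y : L) :
      α (a x y + t • b x y) = a (α x) (α y) + t • b (α x) (α y) := by
    rw [hα.map_add, hα.map_smul, ha, hb]
  obtain ⟨hμμ, hmm, hμm⟩ := (isCompatibleHomLeibniz_iff_balavoine hα hμ₀ hm₀ hcμ₀ hcm₀).mp h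
  have double_eq_zero (v : (Fin 3 → L) → L) : v + v = 0 ↔ v = 0 := by
    rw [← two_smul K, smul_eq_zero_iff_right two_ne_zero]
  have key : (∀ t : K, IsCompatibleHomLeibniz K α (fun x y => μ₀ x y + t • μ₁ x y)
        (fun x y => m₀ x y + t • m₁ x y)) ↔
      (balavoine α 1 1 (c2 μ₀) (c2 μ₁) = 0 ∧
       balavoine α 1 1 (c2 m₀) (c2 m₁) = 0 ∧
       balavoine α 1 1 (c2 μ₀) (c2 m₁) + balavoine α 1 1 (c2 μ₁) (c2 m₀) = 0 ∧
       balavoine α 1 1 (c2 μ₁) (c2 μ₁) = 0 ∧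
       balavoine α 1 1 (c2 m₁) (c2 m₁) = 0 ∧
       balavoine α 1 1 (c2 μ₁) (c2 m₁) = 0) := by
    simp only [fun t : K => isCompatibleHomLeibniz_iff_balavoine hα (hμ₀.add_smul hμ t)
      (hm₀.add_smul hm t) (mult hcμ₀ hcμ t) (mult hcm₀ hcm t),
      balavoine_c2_add_smul α hμ₀ hμ hμ₀ hμ, balavoine_c2_add_smul α hm₀ hm hm₀ hm,
      balavoine_c2_add_smul α hμ₀ hμ hm₀ hm, hμμ, hmm, hμm, zero_add, forall_and,
      forall_smul_add_sq_smul_eq_zero_iff]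
    rw [balavoine_c2_comm α μ₁ μ₀, balavoine_c2_comm α m₁ m₀, double_eq_zero, double_eq_zero]
    tauto
  refine ⟨key, fun hdef => ?_⟩
  obtain ⟨hμ₀μ₁, hm₀m₁, hmixed, hμ₁μ₁, hm₁m₁, hμ₁m₁⟩ := key.mp hdef
  refine ⟨⟨hμ₀μ₁, ?_, hm₀m₁⟩,
    (isCompatibleHomLeibniz_iff_balavoine hα hμ hm hcμ hcm).mpr ⟨hμ₁μ₁, hm₁m₁, hμ₁m₁⟩⟩
  rwa [balavoine_c2_comm α m₀ μ₁, add_comm (balavoine α 1 1 (c2 μ₁) (c2 m₀))]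
end
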